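/- arXiv:2010.11914 — 2 statements merged into one kernel-verified Lean document; each statement's English description precedes it below -/
import Mathlib

section
/- Let N be a finite set and B ⊆ A_N a CI structure with at most one element. Then B is a gaussoid, and for every rational ε > 0 there exists a symmetric positive-definite matrix Σ with rational entries, rows and columns indexed by N, such that CIS(Σ) = B and |Σ_{ab} − I_{ab}| < ε for all a, b ∈ N, where I is the identity matrix. -/
open scoped symmDiff

abbrev CIStmt (N : Type*) := Sym2 N × Finset N

def CIStmt.proper {N : Type*} (s : CIStmt N) : Prop :=
  ¬ s.1.IsDiag ∧ ∀ i ∈ s.1, i ∉ s.2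

variable {N : Type*} [DecidableEq N]

def pminor {R : Type*} [CommRing R] (M : Matrix N N R) (S : Finset N) : R :=
  (M.submatrix (fun a : S => (a : N)) (fun a : S => (a : N))).det

def apminor {R : Type*} [CommRing R] (M : Matrix N N R) (i j : N) (K : Finset N) : R :=
  (Matrix.of fun a b : Unit ⊕ ↥K =>
      M (Sum.elim (fun _ => i) (fun k => (k : N)) a)
        (Sum.elim (fun _ => j) (fun k => (k : N)) b)).det

def PrinReg {R : Type*} [CommRing R] (M : Matrix N N R) : Prop :=
  ∀ S : Finset N, pminor M S ≠ 0

def PosDefMinors {R : Type*} [Field R] [LinearOrder R] [IsStrictOrderedRing R] (M : Matrix N N R) : Prop :=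
  ∀ S : Finset N, 0 < pminor M S

def CIS {R : Type*} [CommRing R] (M : Matrix N N R) : Set (CIStmt N) :=
  {s | s.proper ∧ ∀ i j : N, s.1 = s(i, j) → apminor M i j s.2 = 0}

def IsGaussoid (G : Set (CIStmt N)) : Prop :=
  (∀ s ∈ G, s.proper) ∧
  ∀ i j k : N, ∀ L : Finset N,
    i ≠ j → i ≠ k → j ≠ k → i ∉ L → j ∉ L → k ∉ L →
      (((s(i,j), L) ∈ G ∧ (s(i,k), insert j L) ∈ G) ↔
        ((s(i,k), L) ∈ G ∧ (s(i,j), insert k L) ∈ G)) ∧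
      (((s(i,j), insert k L) ∈ G ∧ (s(i,k), insert j L) ∈ G) ↔
        ((s(i,j), L) ∈ G ∧ (s(i,k), L) ∈ G)) ∧
      (((s(i,j), L) ∈ G ∧ (s(i,j), insert k L) ∈ G) →
        ((s(i,k), L) ∈ G ∨ (s(j,k), L) ∈ G))


open Filter Topology

theorem apminor_schur {N : Type*} [DecidableEq N] (M : Matrix N N ℚ) (l m : N) (L : Finset N)
    (h : pminor M L ≠ 0) :
    apminor M l m L = pminor M L * (M l m - ∑ a : L, ∑ b : L,
      M l a * ((M.submatrix (fun a : L => (a : N)) (fun a : L => (a : N)))⁻¹ a b) * M b m) := by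
  unfold pminor at h ⊢
  set D := M.submatrix (fun a : L => (a : N)) (fun a : L => (a : N)) with hD
  let _ : Invertible D := D.invertibleOfIsUnitDet (isUnit_iff_ne_zero.mpr h)
  have e : (Matrix.of fun a b : Unit ⊕ ↥L =>
      M (Sum.elim (fun _ => l) (fun k => (k : N)) a)
        (Sum.elim (fun _ => m) (fun k => (k : N)) b)) =
      Matrix.fromBlocks (Matrix.of fun _ _ : Unit => M l m) (Matrix.of fun (_ : Unit) (b : L) => M l b)
        (Matrix.of fun (a : L) (_ : Unit) => M a m) D := by
    ext (a | a) (b | b) <;> rfl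
  unfold apminor
  rw [e, Matrix.det_fromBlocks₂₂, Matrix.det_unique (n := Unit), Matrix.invOf_eq_nonsing_inv]
  congr 1
  simp only [Matrix.sub_apply, Matrix.mul_apply, Matrix.of_apply, Finset.sum_mul]
  rw [Finset.sum_comm]

theorem apminor_symm {N : Type*} [DecidableEq N] (M : Matrix N N ℚ) (hM : M.IsSymm) (l m : N)
    (L : Finset N) : apminor M l m L = apminor M m l L := by
  unfold apminor
  rw [← Matrix.det_transpose]
  congr 1
  ext a b
  simp only [Matrix.transpose_apply, Matrix.of_apply]
  exact hM.apply _ _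

/-- The family `1 + t R(t)`. -/
def famSig {N : Type*} [DecidableEq N] (R : ℚ → Matrix N N ℚ) (t : ℚ) : Matrix N N ℚ :=
  1 + t • R t

theorem famSig_off {N : Type*} [DecidableEq N] (R : ℚ → Matrix N N ℚ) (t : ℚ) {a b : N}
    (h : a ≠ b) : famSig R t a b = t * R t a b := by
  simp [famSig, Matrix.one_apply_ne h]

theorem famSig_cont {N : Type*} [DecidableEq N] (R : ℚ → Matrix N N ℚ)
    (hR : ContinuousAt R 0) : ContinuousAt (famSig R) 0 := by
  unfold famSig
  exact continuousAt_const.add (continuousAt_id.smul hR)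

theorem sub_cont {N : Type*} [DecidableEq N] (R : ℚ → Matrix N N ℚ)
    (hR : ContinuousAt R 0) (L : Finset N) :
    ContinuousAt (fun t => (famSig R t).submatrix (fun a : L => (a : N)) (fun a : L => (a : N))) 0 :=
  ContinuousAt.comp (g := fun M : Matrix N N ℚ => M.submatrix (fun a : L => (a : N)) (fun a : L => (a : N)))
    (by fun_prop) (famSig_cont R hR)

theorem sub_zero_eq {N : Type*} [DecidableEq N] (R : ℚ → Matrix N N ℚ) (L : Finset N) :
    (famSig R 0).submatrix (fun a : L => (a : N)) (fun a : L => (a : N)) = 1 := by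
  simp only [famSig, zero_smul, add_zero]
  exact Matrix.submatrix_one _ Subtype.val_injective

theorem inv_cont {N : Type*} [DecidableEq N] (R : ℚ → Matrix N N ℚ)
    (hR : ContinuousAt R 0) (L : Finset N) (a b : L) :
    Tendsto (fun t => ((famSig R t).submatrix (fun a : L => (a : N)) (fun a : L => (a : N)))⁻¹ a b)
      (𝓝 0) (𝓝 ((1 : Matrix L L ℚ) a b)) := by
  have h1 := sub_cont R hR L
  have h2 : ContinuousAt (fun M : Matrix L L ℚ => M⁻¹ a b) 1 := by
    simp only [Matrix.inv_def, Ring.inverse_eq_inv', Matrix.smul_apply, smul_eq_mul]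
    refine ContinuousAt.mul (ContinuousAt.inv₀ ?_ (by simp)) ?_
    · exact (Continuous.matrix_det continuous_id).continuousAt
    · exact ((Continuous.matrix_adjugate continuous_id).matrix_elem a b).continuousAt
  rw [← sub_zero_eq R L] at h2
  have h3 := ContinuousAt.comp (x := (0:ℚ)) h2 h1
  unfold ContinuousAt at h3
  simpa [Function.comp_def, sub_zero_eq] using h3

theorem pminor_ev {N : Type*} [Fintype N] [DecidableEq N] (R : ℚ → Matrix N N ℚ)
    (hR : ContinuousAt R 0) : ∀ᶠ t in 𝓝 (0:ℚ), PosDefMinors (famSig R t) := by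
  unfold PosDefMinors
  rw [eventually_all]
  intro S
  have h : ContinuousAt (fun t => pminor (famSig R t) S) 0 :=
    ContinuousAt.comp (g := Matrix.det)
      (Continuous.matrix_det continuous_id).continuousAt (sub_cont R hR S)
  refine h.eventually_const_lt ?_
  simp [pminor, sub_zero_eq]

theorem elem_cont {N : Type*} {R : ℚ → Matrix N N ℚ}
    (hR : ContinuousAt R 0) (a b : N) : Tendsto (fun t => R t a b) (𝓝 0) (𝓝 (R 0 a b)) :=
  ContinuousAt.comp (x := (0:ℚ)) (g := fun M : Matrix N N ℚ => M a b)
    (Continuous.matrix_elem continuous_id a b).continuousAt hR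

/-- The quadratic form part of the Schur complement. -/
noncomputable def quad {N : Type*} [DecidableEq N] (R : ℚ → Matrix N N ℚ) (l m : N) (L : Finset N) (t : ℚ) : ℚ :=
  ∑ a : L, ∑ b : L, R t l a *
    (((famSig R t).submatrix (fun a : L => (a : N)) (fun a : L => (a : N)))⁻¹ a b) * R t b m

theorem quad_tendsto {N : Type*} [DecidableEq N] (R : ℚ → Matrix N N ℚ)
    (hR : ContinuousAt R 0) (l m : N) (L : Finset N) :
    Tendsto (quad R l m L) (𝓝 0) (𝓝 (∑ a ∈ L, R 0 l a * R 0 a m)) := by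
  have : ∑ a ∈ L, R 0 l a * R 0 a m =
      ∑ a : L, ∑ b : L, R 0 l a * ((1 : Matrix L L ℚ) a b) * R 0 b m := by
    rw [← Finset.sum_coe_sort]
    refine Finset.sum_congr rfl fun a _ => ?_
    simp [Matrix.one_apply]
  rw [this]
  unfold quad
  refine tendsto_finsetSum _ fun a _ => tendsto_finsetSum _ fun b _ => ?_
  exact ((elem_cont hR _ _).mul (inv_cont R hR L a b)).mul (elem_cont hR _ _)

theorem apminor_fam {N : Type*} [DecidableEq N] (R : ℚ → Matrix N N ℚ) (t : ℚ)
    (l m : N) (L : Finset N) (hlm : l ≠ m) (hl : l ∉ L) (hm : m ∉ L)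
    (h : pminor (famSig R t) L ≠ 0) :
    apminor (famSig R t) l m L = pminor (famSig R t) L * (t * (R t l m - t * quad R l m L t)) := by
  rw [apminor_schur _ _ _ _ h, famSig_off _ _ hlm]
  congr 1
  rw [mul_sub]
  congr 1
  unfold quad
  simp only [Finset.mul_sum]
  refine Finset.sum_congr rfl fun a _ => Finset.sum_congr rfl fun b _ => ?_
  have ha : l ≠ (a : N) := fun e => hl (by rw [e]; exact a.2)
  have hb : (b : N) ≠ m := fun e => hm (by rw [← e]; exact b.2)
  rw [famSig_off _ _ ha, famSig_off _ _ hb]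
  ring

theorem fam_ev {N : Type*} [Fintype N] [DecidableEq N] (R : ℚ → Matrix N N ℚ)
    (hR : ContinuousAt R 0) (ε : ℚ) (hε : 0 < ε) :
    ∀ᶠ t in 𝓝[≠] (0:ℚ), PosDefMinors (famSig R t) ∧
      (∀ a b : N, |famSig R t a b - (1 : Matrix N N ℚ) a b| < ε) ∧
      ∀ l m : N, ∀ L : Finset N, l ≠ m → l ∉ L → m ∉ L → R 0 l m ≠ 0 →
        apminor (famSig R t) l m L ≠ 0 := by
  have h1 := (pminor_ev R hR).filter_mono (nhdsWithin_le_nhds (s := {0}ᶜ))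
  have h2 : ∀ᶠ t in 𝓝[≠] (0:ℚ), ∀ a b : N, |famSig R t a b - (1 : Matrix N N ℚ) a b| < ε := by
    refine Eventually.filter_mono nhdsWithin_le_nhds ?_
    rw [eventually_all]; intro a
    rw [eventually_all]; intro b
    have := ((elem_cont (famSig_cont R hR) a b).sub_const ((1 : Matrix N N ℚ) a b)).abs
    refine this.eventually_lt_const ?_
    simpa [famSig] using hε
  have h3 : ∀ᶠ t in 𝓝[≠] (0:ℚ), ∀ l m : N, ∀ L : Finset N, R 0 l m ≠ 0 →
      R t l m - t * quad R l m L t ≠ 0 := by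
    refine Eventually.filter_mono nhdsWithin_le_nhds ?_
    rw [eventually_all]; intro l
    rw [eventually_all]; intro m
    rw [eventually_all]; intro L
    by_cases h0 : R 0 l m = 0
    · simp [h0]
    have := (elem_cont hR l m).sub (tendsto_id.mul (quad_tendsto R hR l m L))
    rw [zero_mul, sub_zero] at this
    exact (this.eventually_ne h0).mono fun t ht _ => ht
  filter_upwards [h1, h2, h3, self_mem_nhdsWithin] with t a1 a2 a3 ht
  refine ⟨a1, a2, fun l m L hlm hl hm h0 => ?_⟩
  rw [apminor_fam R t l m L hlm hl hm (a1 L).ne']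
  exact mul_ne_zero (a1 L).ne' (mul_ne_zero ht (a3 l m L h0))

theorem famSig_symm {N : Type*} [DecidableEq N] (R : ℚ → Matrix N N ℚ) (t : ℚ)
    (h : (R t).IsSymm) : (famSig R t).IsSymm :=
  Matrix.isSymm_one.add (h.smul t)

theorem exists_empty {N : Type*} [Fintype N] [DecidableEq N] (ε : ℚ) (hε : 0 < ε) :
    ∃ Sig : Matrix N N ℚ, Sig.IsSymm ∧ PosDefMinors Sig ∧ CIS Sig = ∅ ∧
        ∀ a b : N, |Sig a b - (1 : Matrix N N ℚ) a b| < ε := by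
  obtain ⟨t, h1, h2, h3⟩ :=
    (fam_ev (fun _ => (Matrix.of fun _ _ => 1 : Matrix N N ℚ)) continuousAt_const ε hε).exists
  refine ⟨_, famSig_symm _ _ (by ext; rfl), h1, ?_, h2⟩
  rw [Set.eq_empty_iff_forall_notMem]
  rintro ⟨s, L⟩ ⟨⟨hd, hp⟩, hz⟩
  induction s with | _ l m
  exact h3 l m L (by simpa using hd) (hp l (by simp)) (hp m (by simp)) (by simp) (hz l m rfl)

/-- The weights. -/
noncomputable def wt {N : Type*} [Fintype N] [DecidableEq N] (i j a : N) : ℚ :=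
  if a = i ∨ a = j then 1 else 2 ^ (Fintype.equivFin N a : ℕ)

/-- First-order coefficients. -/
noncomputable def Cmat {N : Type*} [Fintype N] [DecidableEq N] (i j : N) : Matrix N N ℚ :=
  Matrix.of fun a b => if s(a, b) = s(i, j) then 0 else wt i j a * wt i j b

/-- Indicator of the pair `ij`. -/
def Emat {N : Type*} [DecidableEq N] (i j : N) : Matrix N N ℚ :=
  Matrix.of fun a b => if s(a, b) = s(i, j) then 1 else 0

theorem wt_ne {N : Type*} [Fintype N] [DecidableEq N] (i j a : N) : wt i j a ≠ 0 := by
  unfold wt; split_ifs <;> positivity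

theorem wsum_inj {N : Type*} [Fintype N] [DecidableEq N] (i j : N) (K L : Finset N)
    (hi : i ∉ K) (hj : j ∉ K) (hi' : i ∉ L) (hj' : j ∉ L)
    (h : ∑ a ∈ K, Cmat i j i a * Cmat i j a j = ∑ a ∈ L, Cmat i j i a * Cmat i j a j) :
    K = L := by
  have key : ∀ S : Finset N, i ∉ S → j ∉ S → ∑ a ∈ S, Cmat i j i a * Cmat i j a j =
      ((∑ k ∈ S.map ((Fintype.equivFin N).toEmbedding.trans Fin.valEmbedding), 4 ^ k : ℕ) : ℚ) := by
    intro S hi hj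
    rw [Finset.sum_map]
    push_cast
    refine Finset.sum_congr rfl fun a ha => ?_
    have hai : a ≠ i := fun e => hi (e ▸ ha)
    have haj : a ≠ j := fun e => hj (e ▸ ha)
    have e4 : (4:ℚ) = 2 * 2 := by norm_num
    simp [Cmat, wt, hai, haj, e4, mul_pow]
  rw [key K hi hj, key L hi' hj'] at h
  have := Finset.geomSum_injective (n := 4) (by norm_num) (Nat.cast_injective h)
  exact Finset.map_injective _ this

theorem exists_single {N : Type*} [Fintype N] [DecidableEq N] (i j : N) (K : Finset N)
    (hij : i ≠ j) (hi : i ∉ K) (hj : j ∉ K) (ε : ℚ) (hε : 0 < ε) :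
    ∃ Sig : Matrix N N ℚ, Sig.IsSymm ∧ PosDefMinors Sig ∧ CIS Sig = {(s(i, j), K)} ∧
        ∀ a b : N, |Sig a b - (1 : Matrix N N ℚ) a b| < ε := by
  set C := Cmat i j with hC
  have hCs : C.IsSymm := by
    ext a b
    simp only [hC, Cmat, Matrix.transpose_apply, Matrix.of_apply]
    rw [Sym2.eq_swap, mul_comm]
  have hEs : (Emat i j).IsSymm := by
    ext a b
    simp only [Emat, Matrix.transpose_apply, Matrix.of_apply]
    rw [Sym2.eq_swap]
  let R0 : ℚ → Matrix N N ℚ := fun _ => C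
  have hR0 : ContinuousAt R0 0 := continuousAt_const
  have hu0 := quad_tendsto R0 hR0 i j
  let u : ℚ → ℚ := quad R0 i j K
  let R : ℚ → Matrix N N ℚ := fun t => C + (t * u t) • Emat i j
  have hRz : R 0 = C := by simp [R]
  have hR : ContinuousAt R 0 := by
    have : Tendsto (fun t => t * u t) (𝓝 0) (𝓝 0) := by
      simpa using tendsto_id.mul (hu0 K)
    have h2 := (tendsto_const_nhds (x := C)).add (this.smul_const (Emat i j))
    unfold ContinuousAt
    rw [hRz]
    simpa using h2
  have hRoff : ∀ t a b, s(a, b) ≠ s(i, j) → R t a b = C a b := by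
    intro t a b h
    simp only [R, Emat, Matrix.add_apply, Matrix.smul_apply, Matrix.of_apply, if_neg h, smul_zero, add_zero]
  have hRij : ∀ t, R t i j = t * u t := by
    intro t
    simp [R, Emat, hC, Cmat]
  have hq : ∀ t, ∀ L : Finset N, i ∉ L → j ∉ L → quad R i j L t = quad R0 i j L t := by
    intro t L hi hj
    have hs : (famSig R t).submatrix (fun a : L => (a : N)) (fun a : L => (a : N)) =
        (famSig R0 t).submatrix (fun a : L => (a : N)) (fun a : L => (a : N)) := by
      ext a b
      have : R t a b = R0 t a b := hRoff t a b (by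
        intro e
        have : i ∈ s((a:N), (b:N)) := by rw [e]; simp
        rcases Sym2.mem_iff.mp this with h | h
        · exact hi (h ▸ a.2)
        · exact hi (h ▸ b.2))
      simp [famSig, this]
    unfold quad
    rw [hs]
    refine Finset.sum_congr rfl fun a _ => Finset.sum_congr rfl fun b _ => ?_
    rw [hRoff t i a, hRoff t b j]
    · intro e
      have : i ∈ s((b:N), j) := by rw [e]; simp
      rcases Sym2.mem_iff.mp this with h | h
      · exact hi (h ▸ b.2)
      · exact hij h
    · intro e
      have : j ∈ s(i, (a:N)) := by rw [e]; simp
      rcases Sym2.mem_iff.mp this with h | h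
      · exact hij h.symm
      · exact hj (h ▸ a.2)
  have h3 : ∀ᶠ t in 𝓝[≠] (0:ℚ), ∀ L : Finset N, i ∉ L → j ∉ L → L ≠ K →
      u t - quad R0 i j L t ≠ 0 := by
    refine Eventually.filter_mono nhdsWithin_le_nhds ?_
    rw [eventually_all]; intro L
    by_cases h : i ∉ L ∧ j ∉ L ∧ L ≠ K
    · have := ((hu0 K).sub (hu0 L)).eventually_ne (b₂ := 0) (by
        intro e
        exact h.2.2 (wsum_inj i j K L hi hj h.1 h.2.1 (sub_eq_zero.mp e)).symm)
      exact this.mono fun t ht _ _ _ => ht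
    · exact Eventually.of_forall fun t a b c => (h ⟨a, b, c⟩).elim
  obtain ⟨t, ⟨a1, a2, a3⟩, a4, ht⟩ :=
    ((fam_ev R hR ε hε).and (h3.and self_mem_nhdsWithin)).exists
  have hsym : (famSig R t).IsSymm := famSig_symm _ _ (hCs.add (hEs.smul _))
  have hval : ∀ L : Finset N, i ∉ L → j ∉ L → apminor (famSig R t) i j L =
      pminor (famSig R t) L * (t * (t * (u t - quad R0 i j L t))) := by
    intro L hi hj
    rw [apminor_fam R t i j L hij hi hj (a1 L).ne', hRij, hq t L hi hj]
    ring
  refine ⟨_, hsym, a1, ?_, a2⟩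
  ext ⟨s, L⟩
  rw [Set.mem_singleton_iff]
  constructor
  · rintro ⟨⟨hd, hp⟩, hz⟩
    by_cases hs : s = s(i, j)
    · subst hs
      have hiL := hp i (by simp)
      have hjL := hp j (by simp)
      have h0 := hz i j rfl
      by_contra hne
      have hLK : L ≠ K := fun e => hne (by rw [e])
      rw [hval L hiL hjL] at h0
      exact mul_ne_zero (a1 L).ne' (mul_ne_zero ht (mul_ne_zero ht (a4 L hiL hjL hLK))) h0
    · exfalso
      induction s with | _ l m
      refine a3 l m L (by simpa using hd) (hp l (by simp)) (hp m (by simp)) ?_ (hz l m rfl)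
      rw [hRz]
      simp only [hC, Cmat, Matrix.of_apply, if_neg hs]
      exact mul_ne_zero (wt_ne _ _ _) (wt_ne _ _ _)
  · intro e
    obtain ⟨rfl, rfl⟩ := Prod.mk.inj e
    have hzero : apminor (famSig R t) i j L = 0 := by
      rw [hval L hi hj]
      simp [u]
    refine ⟨⟨by simpa using hij, ?_⟩, ?_⟩
    · intro a ha
      rcases Sym2.mem_iff.mp ha with rfl | rfl
      · exact hi
      · exact hj
    · intro a b hab
      rcases Sym2.eq_iff.mp hab with ⟨rfl, rfl⟩ | ⟨rfl, rfl⟩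
      · exact hzero
      · rw [apminor_symm _ hsym]; exact hzero

/-- every CI structure with at most one element is a gaussoid and is
rationally realizable by positive-definite matrices arbitrarily close to the identity. -/
theorem stmt11 {N : Type*} [Fintype N] [DecidableEq N]
    (B : Set (CIStmt N)) (hBproper : ∀ s ∈ B, s.proper) (hBcard : B.encard ≤ 1) :
    IsGaussoid B ∧
    ∀ ε : ℚ, 0 < ε →
      ∃ Sig : Matrix N N ℚ, Sig.IsSymm ∧ PosDefMinors Sig ∧ CIS Sig = B ∧
        ∀ a b : N, |Sig a b - (1 : Matrix N N ℚ) a b| < ε := by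
  have hsub := Set.encard_le_one_iff_subsingleton.mp hBcard
  refine ⟨⟨hBproper, ?_⟩, ?_⟩
  · intro i j k L hij hik hjk hi hj hk
    have ins : ∀ (x y : Sym2 N) (a : N), a ∉ L → (x, L) ∈ B → (y, insert a L) ∈ B → False := by
      intro x y a ha h1 h2
      have := (Prod.mk.inj (hsub h1 h2)).2
      exact ha (this ▸ Finset.mem_insert_self a L)
    refine ⟨⟨fun h => (ins _ _ _ hj h.1 h.2).elim, fun h => (ins _ _ _ hk h.1 h.2).elim⟩,
      ⟨fun h => ?_, fun h => ?_⟩, fun h => (ins _ _ _ hk h.1 h.2).elim⟩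
    · have e := (Prod.mk.inj (hsub h.1 h.2)).2
      have : k ∈ insert j L := e ▸ Finset.mem_insert_self k L
      rcases Finset.mem_insert.mp this with h | h
      · exact (hjk h.symm).elim
      · exact (hk h).elim
    · have e := (Prod.mk.inj (hsub h.1 h.2)).1
      exact (hjk (Sym2.congr_right.mp e)).elim
  · intro ε hε
    rcases hsub.eq_empty_or_singleton with rfl | ⟨⟨s, K⟩, rfl⟩
    · exact exists_empty ε hε
    · obtain ⟨hd, hp⟩ := hBproper _ rfl
      induction s with | _ i j
      exact exists_single i j K (by simpa using hd) (hp i (by simp)) (hp j (by simp)) ε hε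
end

section
/- Let i, j be two distinct elements, M a finite set with |M| ≥ 2 disjoint from {i,j}, and N = {i,j} ∪ M. Let G = {(ij|∅), (ij|M)} ⊆ A_N. Then G is a gaussoid, and for every diagonal matrix J indexed by N with all diagonal entries in {+1, −1} and every rational ε > 0, there exists a principally regular symmetric matrix Γ with rational entries, indexed by N, such that CIS(Γ) = G and |Γ_{ab} − J_{ab}| < ε for all a, b ∈ N. -/
open scoped symmDiff

variable {N : Type*} [DecidableEq N]

/-- the polynomial family of matrices -/
def famA {N R : Type*} [DecidableEq N] [CommRing R] (J : N → R) (b : N → N → R) (p q : N) : R :=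
  if p = q then J p else b p q + b q p

def famU {N R : Type*} [DecidableEq N] [CommRing R] (M : Finset N) (J : N → R) (b : N → N → R)
    (x : N → R) (q : N) : R := ∑ m ∈ M, famA J b q m * x m

def famV {N R : Type*} [CommRing R] (M : Finset N) (c : N → N → R)
    (x : N → R) (q : N) : R := ∑ m ∈ M, (c q m - c m q) * x m

def fam {N R : Type*} [DecidableEq N] [CommRing R] (i j : N) (M : Finset N) (J : N → R)
    (b c : N → N → R) (x : N → R) : Matrix N N R := fun p q =>
  if p = q then J p
  else if p = i then (if q = j then 0 else famU M J b x q)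
  else if p = j then (if q = i then 0 else famV M c x q)
  else if q = i then famU M J b x p
  else if q = j then famV M c x p
  else famA J b p q

lemma famA_symm {N R : Type*} [DecidableEq N] [CommRing R] (J : N → R) (b : N → N → R) (p q : N) :
    famA J b p q = famA J b q p := by
  unfold famA
  by_cases h : p = q
  · subst h; rfl
  · rw [if_neg h, if_neg (Ne.symm h), add_comm]

lemma fam_symm {N R : Type*} [DecidableEq N] [CommRing R] (i j : N) (M : Finset N) (J : N → R)
    (b c : N → N → R) (x : N → R) (hij : i ≠ j) : (fam i j M J b c x).IsSymm := by
  ext p q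
  rw [Matrix.transpose_apply]
  have := famA_symm J b p q
  unfold fam
  rw [this]
  by_cases hpq : p = q
  · subst hpq; rfl
  rw [if_neg hpq, if_neg (Ne.symm hpq)]
  have hji := hij.symm
  by_cases h1 : p = i
  · subst h1
    by_cases h2 : q = j
    · subst h2; simp [hji]
    · simp [h2, Ne.symm hpq]
  by_cases h2 : p = j
  · subst h2
    by_cases h3 : q = i
    · subst h3; simp [h1]
    · simp [h3, h1, Ne.symm hpq]
  simp [h1, h2]

lemma fam_map {N R S : Type*} [DecidableEq N] [CommRing R] [CommRing S] (f : R →+* S)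
    (i j : N) (M : Finset N) (J : N → R)
    (b c : N → N → R) (x : N → R) (p q : N) :
    f (fam i j M J b c x p q) =
      fam i j M (fun a => f (J a)) (fun a d => f (b a d)) (fun a d => f (c a d)) (fun a => f (x a)) p q := by
  simp only [fam, famU, famV, famA, apply_ite f, map_sum, map_mul, map_add, map_sub, map_zero]

lemma apminor_eq {N R : Type*} [DecidableEq N] [CommRing R]
    (A : Matrix N N R) (a b : N) (K : Finset N) :
    apminor A a b K = (Matrix.of fun p q : Unit ⊕ ↥K =>
      A (Sum.elim (fun _ : Unit => a) (fun k : K => (k : N)) p)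
        (Sum.elim (fun _ : Unit => b) (fun k : K => (k : N)) q)).det := by
  unfold apminor
  congr 1
  ext p q
  rcases p with p | p <;> rcases q with q | q <;> rfl

lemma apminor_map {N R S : Type*} [DecidableEq N] [CommRing R] [CommRing S] (f : R →+* S)
    (A : Matrix N N R) (a b : N) (K : Finset N) :
    f (apminor A a b K) = apminor (A.map f) a b K := by
  rw [apminor_eq, apminor_eq]
  rw [RingHom.map_det]
  rfl

lemma pminor_map {N R S : Type*} [DecidableEq N] [CommRing R] [CommRing S] (f : R →+* S)
    (A : Matrix N N R) (K : Finset N) :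
    f (pminor A K) = pminor (A.map f) K := by
  unfold pminor
  rw [RingHom.map_det]
  rfl

lemma apminor_symm_s14 {N R : Type*} [DecidableEq N] [CommRing R]
    (A : Matrix N N R) (h : A.IsSymm) (a b : N) (K : Finset N) :
    apminor A a b K = apminor A b a K := by
  rw [apminor_eq, apminor_eq]
  rw [← Matrix.det_transpose]
  congr 1
  ext p q
  simp only [Matrix.transpose_apply, Matrix.of_apply]
  exact h.apply _ _

lemma apminor_zero_row {N R : Type*} [DecidableEq N] [CommRing R]
    (A : Matrix N N R) (a b : N) (K : Finset N) (h : ∀ k ∈ K, A a k = 0) :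
    apminor A a b K = A a b * pminor A K := by
  rw [apminor_eq]
  unfold pminor
  have : (Matrix.of fun p q : Unit ⊕ ↥K =>
      A (Sum.elim (fun _ : Unit => a) (fun k : K => (k : N)) p)
        (Sum.elim (fun _ : Unit => b) (fun k : K => (k : N)) q)) =
      Matrix.fromBlocks (Matrix.of fun _ _ : Unit => A a b) 0 (Matrix.of fun (k : K) (_ : Unit) => A k b)
        (A.submatrix (fun a : K => (a : N)) (fun a : K => (a : N))) := by
    ext p q
    rcases p with p | p <;> rcases q with q | q <;> simp [h]
  rw [this, Matrix.det_fromBlocks_zero₁₂]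
  simp

lemma apminor_empty {N R : Type*} [DecidableEq N] [CommRing R]
    (A : Matrix N N R) (a b : N) : apminor A a b ∅ = A a b := by
  rw [apminor_zero_row _ _ _ _ (by simp)]
  simp [pminor]

lemma pminor_ne_zero {N : Type*} [DecidableEq N] (A : Matrix N N ℚ) (K : Finset N) (σ : N → N)
    (hd : ∀ k ∈ K, |A k k| = 1)
    (ho : ∀ k ∈ K, ∀ l ∈ K, k ≠ l → |A k l| ≤ if l = σ k then 1 / 2 else 0) :
    pminor A K ≠ 0 := by
  unfold pminor
  intro h0
  obtain ⟨z, hz, hz0⟩ := Matrix.exists_mulVec_eq_zero_iff.mpr h0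
  obtain ⟨k₁, hk₁⟩ := Function.ne_iff.mp hz
  obtain ⟨k, -, hk⟩ := Finset.exists_max_image (Finset.univ : Finset K) (fun k => |z k|) ⟨k₁, Finset.mem_univ _⟩
  have hpos : 0 < |z k| := lt_of_lt_of_le (abs_pos.mpr hk₁) (hk k₁ (Finset.mem_univ _))
  have h1 := congrFun hz0 k
  simp only [Matrix.mulVec, dotProduct, Matrix.submatrix_apply, Pi.zero_apply] at h1
  rw [← Finset.add_sum_erase _ _ (Finset.mem_univ k)] at h1
  have h2 : |∑ l ∈ Finset.univ.erase k, A k l * z l| ≤ 1 / 2 * |z k| := by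
    refine (Finset.abs_sum_le_sum_abs _ _).trans ?_
    have : ∀ l ∈ Finset.univ.erase k, |A k l * z l| ≤ if (l : N) = σ k then 1 / 2 * |z k| else 0 := by
      intro l hl
      have hkl : (k : N) ≠ l := fun h => (Finset.ne_of_mem_erase hl) (Subtype.ext h.symm)
      have := ho k k.2 l l.2 hkl
      rw [abs_mul]
      split_ifs at this ⊢ with hh
      · exact mul_le_mul this (hk l (Finset.mem_univ _)) (abs_nonneg _) (by norm_num)
      · have : |A k l| = 0 := le_antisymm this (abs_nonneg _)
        simp [this]
    refine (Finset.sum_le_sum this).trans ?_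
    rw [← Finset.sum_filter, Finset.sum_const, nsmul_eq_mul]
    have hc : ((Finset.univ.erase k).filter (fun l : K => (l : N) = σ k)).card ≤ 1 := by
      rw [Finset.card_le_one]
      intro a ha b hb
      simp only [Finset.mem_filter] at ha hb
      exact Subtype.ext (ha.2.trans hb.2.symm)
    have hc' : (((Finset.univ.erase k).filter (fun l : K => (l : N) = σ k)).card : ℚ) ≤ 1 := by
      exact_mod_cast hc
    nlinarith
  have h3 : |A k k * z k| = |z k| := by rw [abs_mul, hd k k.2, one_mul]
  rw [eq_neg_of_add_eq_zero_left h1, abs_neg] at h3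
  linarith

lemma apminor_ne_zero_of_diag {N : Type*} [DecidableEq N] (A : Matrix N N ℚ) (a b : N) (K : Finset N)
    (k₀ : N) (hk₀ : k₀ ∈ K)
    (hd : ∀ k ∈ K, A k k ≠ 0) (ho : ∀ k ∈ K, ∀ l ∈ K, k ≠ l → A k l = 0)
    (hab : A a b = 0) (hak : ∀ k ∈ K, k ≠ k₀ → A a k = 0) (h1 : A a k₀ ≠ 0) (h2 : A k₀ b ≠ 0) :
    apminor A a b K ≠ 0 := by
  rw [apminor_eq]
  intro h0
  obtain ⟨z, hz, hz0⟩ := Matrix.exists_mulVec_eq_zero_iff.mpr h0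
  have hrow : ∀ k : K, A k b * z (Sum.inl ()) + A k k * z (Sum.inr k) = 0 := by
    intro k
    have := congrFun hz0 (Sum.inr k)
    simp only [Matrix.mulVec, dotProduct, Matrix.of_apply, Fintype.sum_sum_type, Sum.elim_inl,
      Sum.elim_inr, Finset.univ_unique, Finset.sum_singleton, Pi.zero_apply] at this
    rw [Finset.sum_eq_single k] at this
    · exact this
    · intro l _ hl
      rw [ho k k.2 l l.2 (fun h => hl (Subtype.ext h.symm)), zero_mul]
    · simp
  have ha : z (Sum.inr ⟨k₀, hk₀⟩) = 0 := by
    have := congrFun hz0 (Sum.inl ())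
    simp only [Matrix.mulVec, dotProduct, Matrix.of_apply, Fintype.sum_sum_type, Sum.elim_inl,
      Sum.elim_inr, Finset.univ_unique, Finset.sum_singleton, Pi.zero_apply] at this
    rw [hab, Finset.sum_eq_single ⟨k₀, hk₀⟩] at this
    · simpa [h1] using this
    · intro l _ hl
      rw [hak l l.2 (fun h => hl (Subtype.ext h)), zero_mul]
    · simp
  have hb : z (Sum.inl ()) = 0 := by
    have := hrow ⟨k₀, hk₀⟩
    simpa [ha, h2] using this
  apply hz
  ext p
  rcases p with p | p
  · exact hb
  · have := hrow p
    simpa [hb, hd p p.2] using this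

lemma apminor_fam_M {N R : Type*} [DecidableEq N] [CommRing R] [IsDomain R]
    (i j : N) (M : Finset N) (J : N → R)
    (b c : N → N → R) (x : N → R) (hij : i ≠ j) (hiM : i ∉ M) (hjM : j ∉ M) :
    apminor (fam i j M J b c x) i j M = 0 := by
  rw [apminor_eq]
  apply Matrix.exists_vecMul_eq_zero_iff.mp
  refine ⟨Sum.elim (fun _ => 1) (fun m => - x m), ?_, ?_⟩
  · intro h
    have := congrFun h (Sum.inl ())
    simp at this
  have hA : ∀ p ∈ M, ∀ q ∈ M, fam i j M J b c x p q = famA J b p q := by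
    intro p hp q hq
    have h1 : p ≠ i := fun h => hiM (h ▸ hp)
    have h2 : p ≠ j := fun h => hjM (h ▸ hp)
    have h3 : q ≠ i := fun h => hiM (h ▸ hq)
    have h4 : q ≠ j := fun h => hjM (h ▸ hq)
    simp only [fam, h1, h2, h3, h4, if_false, famA]
    split_ifs <;> rfl
  have hU : ∀ q ∈ M, fam i j M J b c x i q = famU M J b x q := by
    intro q hq
    have h3 : i ≠ q := fun h => hiM (h ▸ hq)
    have h4 : q ≠ j := fun h => hjM (h ▸ hq)
    simp [fam, h3, h4]
  have hV : ∀ q ∈ M, fam i j M J b c x q j = famV M c x q := by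
    intro q hq
    have h3 : q ≠ i := fun h => hiM (h ▸ hq)
    have h4 : q ≠ j := fun h => hjM (h ▸ hq)
    simp [fam, h3, h4, hij.symm]
  have h0 : fam i j M J b c x i j = 0 := by simp [fam, hij]
  ext q
  simp only [Matrix.vecMul, dotProduct, Matrix.of_apply, Fintype.sum_sum_type, Sum.elim_inl,
      Sum.elim_inr, Finset.univ_unique, Finset.sum_singleton, Pi.zero_apply]
  rcases q with q | q
  · simp only [Sum.elim_inl, h0, mul_zero, zero_add]
    rw [Finset.sum_coe_sort M (fun m => - x m * fam i j M J b c x m j)]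
    rw [Finset.sum_congr rfl (fun m hm => by rw [hV m hm])]
    simp only [famV, Finset.mul_sum]
    have e1 : ∑ m ∈ M, ∑ n ∈ M, -x m * ((c m n - c n m) * x n) =
        (∑ m ∈ M, ∑ n ∈ M, x m * c n m * x n) - ∑ m ∈ M, ∑ n ∈ M, x m * c m n * x n := by
      simp only [← Finset.sum_sub_distrib]
      exact Finset.sum_congr rfl fun m _ => Finset.sum_congr rfl fun n _ => by ring
    rw [e1, Finset.sum_comm, sub_eq_zero]
    exact Finset.sum_congr rfl fun m _ => Finset.sum_congr rfl fun n _ => by ring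
  · simp only [Sum.elim_inr, one_mul]
    rw [Finset.sum_coe_sort M (fun m => - x m * fam i j M J b c x m q), hU q q.2]
    rw [Finset.sum_congr rfl (fun m hm => by rw [hA m hm q q.2])]
    unfold famU
    rw [← Finset.sum_add_distrib]
    apply Finset.sum_eq_zero
    intro m _
    rw [famA_symm J b m q]
    ring

lemma exists_small_point {σ ι : Type*} [Fintype ι] (f : ι → MvPolynomial σ ℚ) (δ : ℚ) (hδ : 0 < δ) :
    ∃ z : σ → ℚ, (∀ k, |z k| < δ) ∧ ∀ a, f a ≠ 0 → MvPolynomial.eval z (f a) ≠ 0 := by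
  classical
  by_contra! hcon
  have hprod : (∏ a, if f a = 0 then 1 else f a) ≠ 0 := by
    rw [Finset.prod_ne_zero_iff]
    intro a _
    split_ifs with h
    · exact one_ne_zero
    · exact h
  apply hprod
  refine MvPolynomial.funext_set (fun _ => Set.Ioo (-δ) δ) (fun _ => Set.Ioo_infinite (by linarith)) ?_
  intro z hz
  obtain ⟨a, ha, ha'⟩ := hcon z (fun k => abs_lt.mpr (hz k (Set.mem_univ _)))
  rw [map_prod, map_zero]
  apply Finset.prod_eq_zero (Finset.mem_univ a)
  rw [if_neg ha, ha']

/-- every non-forced almost-principal minor is nonzero somewhere on the family -/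
lemma exists_point {N : Type*} [DecidableEq N]
    (i j : N) (M : Finset N)
    (hij : i ≠ j) (hMcard : 2 ≤ M.card) (hiM : i ∉ M) (hjM : j ∉ M)
    (hN : ∀ x : N, x = i ∨ x = j ∨ x ∈ M) (J : N → ℚ) (hJ : ∀ a, J a = 1 ∨ J a = -1)
    (s : CIStmt N) (hs : s.proper)
    (hsG : s ∉ ({(s(i, j), (∅ : Finset N)), (s(i, j), M)} : Set (CIStmt N))) :
    ∃ p q : N, s.1 = s(p, q) ∧ ∃ (b c : N → N → ℚ) (x : N → ℚ),
      apminor (fam i j M J b c x) p q s.2 ≠ 0 := by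
  have hJ0 : ∀ a, J a ≠ 0 := fun a => by rcases hJ a with h | h <;> rw [h] <;> norm_num
  have hJ1 : ∀ a, |J a| = 1 := fun a => by rcases hJ a with h | h <;> rw [h] <;> norm_num
  obtain ⟨e, K⟩ := s
  have key1 : ∀ p ∈ M, ∀ q ∈ M, p ≠ q → p ∉ K → q ∉ K → ∃ (b c : N → N → ℚ) (x : N → ℚ),
      apminor (fam i j M J b c x) p q K ≠ 0 := by
    intro p hp q hq hpq hpK hqK
    refine ⟨fun a d => if a = p ∧ d = q then 1 else 0, 0, 0, ?_⟩
    rw [apminor_zero_row]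
    · refine mul_ne_zero ?_ (pminor_ne_zero _ _ id ?_ ?_)
      · have h1 : p ≠ i := fun h => hiM (h ▸ hp)
        have h2 : p ≠ j := fun h => hjM (h ▸ hp)
        have h3 : q ≠ i := fun h => hiM (h ▸ hq)
        have h4 : q ≠ j := fun h => hjM (h ▸ hq)
        simp [fam, famA, *]
      · intro k _; simp [fam, hJ1]
      · intro k hk l hl hkl
        have h5 : k ≠ p := fun h => hpK (h ▸ hk)
        have h6 : l ≠ p := fun h => hpK (h ▸ hl)
        simp [fam, famA, famU, famV, *]
        split_ifs <;> norm_num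
    · intro k hk
      have h5 : k ≠ p := fun h => hpK (h ▸ hk)
      have h6 : k ≠ q := fun h => hqK (h ▸ hk)
      simp [fam, famA, famU, famV, *]
      simp [Ne.symm h5]
  have key2 : ∀ m ∈ M, i ∉ K → m ∉ K → ∃ (b c : N → N → ℚ) (x : N → ℚ),
      apminor (fam i j M J b c x) i m K ≠ 0 := by
    intro m hm hiK hmK
    refine ⟨0, 0, fun a => if a = m then 1 else 0, ?_⟩
    have h1 : m ≠ i := fun h => hiM (h ▸ hm)
    have h2 : m ≠ j := fun h => hjM (h ▸ hm)
    rw [apminor_zero_row]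
    · refine mul_ne_zero ?_ (pminor_ne_zero _ _ id ?_ ?_)
      · simp [fam, famA, famU, h1.symm, *]
      · intro k _; simp [fam, hJ1]
      · intro k hk l hl hkl
        have h5 : k ≠ i := fun h => hiK (h ▸ hk)
        have h6 : l ≠ i := fun h => hiK (h ▸ hl)
        simp [fam, famA, famU, famV, *]
        split_ifs <;> norm_num
    · intro k hk
      have h5 : i ≠ k := fun h => hiK (h ▸ hk)
      have h6 : k ≠ m := fun h => hmK (h ▸ hk)
      simp [fam, famA, famU, famV, *]
  have key3 : ∀ m ∈ M, j ∉ K → m ∉ K → ∃ (b c : N → N → ℚ) (x : N → ℚ),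
      apminor (fam i j M J b c x) j m K ≠ 0 := by
    intro m hm hjK hmK
    obtain ⟨n, hn, hnm⟩ := Finset.exists_mem_ne (s := M) (by omega) m
    refine ⟨0, fun a d => if a = m ∧ d = n then 1 else 0, fun a => if a = n then 1 / 2 else 0, ?_⟩
    have h1 : m ≠ i := fun h => hiM (h ▸ hm)
    have h2 : m ≠ j := fun h => hjM (h ▸ hm)
    have h3 : n ≠ i := fun h => hiM (h ▸ hn)
    have h4 : n ≠ j := fun h => hjM (h ▸ hn)
    rw [apminor_zero_row]
    · refine mul_ne_zero ?_ (pminor_ne_zero _ _ (fun a => if a = i then n else i) ?_ ?_)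
      · simp [fam, famA, famU, famV, h2.symm, hij.symm, hnm.symm, *]
      · intro k _; simp [fam, hJ1]
      · intro k hk l hl hkl
        have h5 : k ≠ j := fun h => hjK (h ▸ hk)
        have h6 : l ≠ j := fun h => hjK (h ▸ hl)
        by_cases hki : k = i
        · subst hki
          by_cases hln : l = n
          · subst hln
            simp [fam, famA, famU, hkl, h6, hn, abs_mul, hJ1]
          · simp [fam, famA, famU, hkl, h6, hn, hln]
        · by_cases hli : l = i
          · subst hli
            by_cases hkn : k = n
            · subst hkn
              simp [fam, famA, famU, hkl, h5, hn, abs_mul, hJ1]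
            · simp [fam, famA, famU, hkl, h5, hn, hkn]
          · simp [fam, famA, hkl, h5, h6, hki, hli]
    · intro k hk
      have h5 : j ≠ k := fun h => hjK (h ▸ hk)
      have h6 : k ≠ m := fun h => hmK (h ▸ hk)
      simp [fam, famA, famU, famV, hij.symm, hnm, *]
  have key4 : K ≠ ∅ → K ≠ M → i ∉ K → j ∉ K → ∃ (b c : N → N → ℚ) (x : N → ℚ),
      apminor (fam i j M J b c x) i j K ≠ 0 := by
    intro hK0 hKM hiK hjK
    have hsub : K ⊆ M := by
      intro k hk
      rcases hN k with h | h | h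
      · exact absurd (h ▸ hk) hiK
      · exact absurd (h ▸ hk) hjK
      · exact h
    obtain ⟨k₀, hk₀⟩ := Finset.nonempty_iff_ne_empty.mpr hK0
    obtain ⟨n, hn, hnK⟩ := Finset.exists_of_ssubset (hsub.ssubset_of_ne hKM)
    have hk₀M := hsub hk₀
    have hnk : n ≠ k₀ := fun h => hnK (h ▸ hk₀)
    have h1 : k₀ ≠ i := fun h => hiK (h ▸ hk₀)
    have h2 : k₀ ≠ j := fun h => hjK (h ▸ hk₀)
    have hi : ∀ k ∈ K, k ≠ i := fun k hk h => hiK (h ▸ hk)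
    have hj : ∀ k ∈ K, k ≠ j := fun k hk h => hjK (h ▸ hk)
    have hn' : ∀ k ∈ K, k ≠ n := fun k hk h => hnK (h ▸ hk)
    refine ⟨0, fun a d => if a = k₀ ∧ d = n then 1 else 0,
      fun a => (if a = k₀ then 1 else 0) + (if a = n then 1 else 0), ?_⟩
    apply apminor_ne_zero_of_diag _ _ _ _ k₀ hk₀
    · intro k hk
      simp [fam, hJ0]
    · intro k hk l hl hkl
      simp [fam, famA, hkl, hi k hk, hj k hk, hi l hl, hj l hl]
    · simp [fam, hij]
    · intro k hk hkk
      simp [fam, famU, famA, (hi k hk).symm, hj k hk, mul_add, Finset.sum_add_distrib, hkk, hn' k hk]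
    · simp [fam, famU, famA, h1.symm, h2, mul_add, Finset.sum_add_distrib, hnk.symm, hk₀M, hJ0]
    · simp [fam, famV, h1, h2, hij.symm, mul_add, Finset.sum_add_distrib, hnk, hnk.symm, hk₀M, hn]
  induction e using Sym2.ind with
  | _ p q =>
  obtain ⟨hd, hK⟩ := hs
  simp only [Sym2.mk_isDiag_iff, Sym2.mem_iff] at hd hK
  have hpK : p ∉ K := hK p (Or.inl rfl)
  have hqK : q ∉ K := hK q (Or.inr rfl)
  simp only [Set.mem_insert_iff, Set.mem_singleton_iff, Prod.mk.injEq, not_or, not_and] at hsG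
  rcases hN p with rfl | rfl | hp <;> rcases hN q with rfl | rfl | hq
  · exact absurd rfl hd
  · exact ⟨_, _, rfl, key4 (hsG.1 rfl) (hsG.2 rfl) hpK hqK⟩
  · exact ⟨_, _, rfl, key2 q hq hpK hqK⟩
  · exact ⟨_, _, Sym2.eq_swap, key4 (hsG.1 Sym2.eq_swap) (hsG.2 Sym2.eq_swap) hqK hpK⟩
  · exact absurd rfl hd
  · exact ⟨_, _, rfl, key3 q hq hpK hqK⟩
  · exact ⟨_, _, Sym2.eq_swap, key2 p hp hqK hpK⟩
  · exact ⟨_, _, Sym2.eq_swap, key3 p hp hqK hpK⟩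
  · exact ⟨_, _, rfl, key1 p hp q hq hd hpK hqK⟩

lemma fam_near {N : Type*} [DecidableEq N]
    (i j : N) (M : Finset N) (hMcard : 2 ≤ M.card)
    (J : N → ℚ) (hJ1 : ∀ a, |J a| = 1) (b c : N → N → ℚ) (x : N → ℚ) (δ ε : ℚ) (hδ : 0 < δ)
    (hδ2 : δ ≤ 1 / 2) (hδε : M.card * δ < ε) (hb : ∀ p q, |b p q| < δ) (hc : ∀ p q, |c p q| < δ)
    (hx : ∀ p, |x p| < δ) (p q : N) :
    |fam i j M J b c x p q - Matrix.diagonal J p q| < ε := by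
  have hε : 0 < ε := lt_of_le_of_lt (by positivity) hδε
  have hA : ∀ p q, |famA J b p q| ≤ 1 := by
    intro p q
    unfold famA
    split_ifs
    · exact (hJ1 p).le
    · have := abs_add_le (b p q) (b q p)
      linarith [hb p q, hb q p]
  have hU : ∀ q, |famU M J b x q| < ε := by
    intro q
    refine lt_of_le_of_lt ?_ hδε
    refine (Finset.abs_sum_le_sum_abs _ _).trans ?_
    rw [← nsmul_eq_mul]
    apply Finset.sum_le_card_nsmul
    intro m _
    rw [abs_mul]
    nlinarith [hA q m, hx m, abs_nonneg (x m)]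
  have hV : ∀ q, |famV M c x q| < ε := by
    intro q
    refine lt_of_le_of_lt ?_ hδε
    refine (Finset.abs_sum_le_sum_abs _ _).trans ?_
    rw [← nsmul_eq_mul]
    apply Finset.sum_le_card_nsmul
    intro m _
    rw [abs_mul]
    have h1 : |c q m - c m q| ≤ 1 := by
      have := abs_sub (c q m) (c m q)
      linarith [hc q m, hc m q]
    nlinarith [hx m, abs_nonneg (x m)]
  by_cases hpq : p = q
  · subst hpq
    simpa [fam] using hε
  · rw [Matrix.diagonal_apply_ne _ hpq, sub_zero]
    unfold fam
    rw [if_neg hpq]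
    split_ifs
    · simpa using hε
    · exact hU q
    · simpa using hε
    · exact hV q
    · exact hU p
    · exact hV p
    · unfold famA
      rw [if_neg hpq]
      have := abs_add_le (b p q) (b q p)
      have h2 : (2 : ℚ) ≤ M.card := by exact_mod_cast hMcard
      nlinarith [hb p q, hb q p]

lemma gaussoid_part {N : Type*} [DecidableEq N]
    (i j : N) (M : Finset N)
    (hij : i ≠ j) (hMcard : 2 ≤ M.card) (hiM : i ∉ M) (hjM : j ∉ M) :
    IsGaussoid ({(s(i, j), (∅ : Finset N)), (s(i, j), M)} : Set (CIStmt N)) := by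
  have hmem : ∀ e L, (e, L) ∈ ({(s(i, j), (∅ : Finset N)), (s(i, j), M)} : Set (CIStmt N)) →
      e = s(i, j) ∧ (L = ∅ ∨ L = M) := by
    intro e L h
    simp only [Set.mem_insert_iff, Set.mem_singleton_iff, Prod.mk.injEq] at h
    tauto
  refine ⟨?_, ?_⟩
  · intro s hs
    obtain ⟨e, L⟩ := s
    obtain ⟨rfl, h⟩ := hmem _ _ hs
    refine ⟨by simpa using hij, ?_⟩
    intro a ha
    simp only [Sym2.mem_iff] at ha
    rcases h with rfl | rfl
    · simp
    · rcases ha with rfl | rfl <;> assumption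
  · intro a b c L hab hac hbc haL hbL hcL
    have hno : ∀ L₁ L₂, (s(a, b), L₁) ∈ ({(s(i, j), (∅ : Finset N)), (s(i, j), M)} : Set (CIStmt N)) →
        (s(a, c), L₂) ∈ ({(s(i, j), (∅ : Finset N)), (s(i, j), M)} : Set (CIStmt N)) → False := by
      intro L₁ L₂ h1 h2
      have := (hmem _ _ h1).1.trans (hmem _ _ h2).1.symm
      exact hbc (Sym2.congr_right.mp this)
    refine ⟨⟨fun h => (hno _ _ h.1 h.2).elim, fun h => (hno _ _ h.2 h.1).elim⟩,
      ⟨fun h => (hno _ _ h.1 h.2).elim, fun h => (hno _ _ h.1 h.2).elim⟩, fun h => ?_⟩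
    exfalso
    obtain ⟨-, h1⟩ := hmem _ _ h.1
    obtain ⟨-, h2⟩ := hmem _ _ h.2
    rcases h2 with h2 | h2
    · exact Finset.insert_ne_empty _ _ h2
    · rcases h1 with rfl | rfl
      · rw [← h2] at hMcard
        simp at hMcard
      · exact hcL (h2 ▸ Finset.mem_insert_self c L)

theorem stmt14 {N : Type*} [Fintype N] [DecidableEq N]
    (i j : N) (M : Finset N)
    (hij : i ≠ j) (hMcard : 2 ≤ M.card) (hiM : i ∉ M) (hjM : j ∉ M)
    (hN : ∀ x : N, x = i ∨ x = j ∨ x ∈ M) :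
    IsGaussoid ({(s(i, j), (∅ : Finset N)), (s(i, j), M)} : Set (CIStmt N)) ∧
    ∀ J : N → ℚ, (∀ a, J a = 1 ∨ J a = -1) → ∀ ε : ℚ, 0 < ε →
      ∃ Γ : Matrix N N ℚ, Γ.IsSymm ∧ PrinReg Γ ∧
        CIS Γ = ({(s(i, j), (∅ : Finset N)), (s(i, j), M)} : Set (CIStmt N)) ∧
        ∀ a b : N, |Γ a b - Matrix.diagonal J a b| < ε := by
  refine ⟨gaussoid_part i j M hij hMcard hiM hjM, ?_⟩
  intro J hJ ε hε
  have hJ1 : ∀ a, |J a| = 1 := fun a => by rcases hJ a with h | h <;> rw [h] <;> norm_num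
  let P : Matrix N N (MvPolynomial ((N × N) ⊕ (N × N) ⊕ N) ℚ) :=
    fam i j M (fun a => MvPolynomial.C (J a))
      (fun p q => MvPolynomial.X (Sum.inl (p, q)))
      (fun p q => MvPolynomial.X (Sum.inr (Sum.inl (p, q))))
      (fun p => MvPolynomial.X (Sum.inr (Sum.inr p)))
  have hP : ∀ z : (N × N) ⊕ (N × N) ⊕ N → ℚ, P.map (MvPolynomial.eval z) =
      fam i j M J (fun p q => z (Sum.inl (p, q))) (fun p q => z (Sum.inr (Sum.inl (p, q))))
        (fun p => z (Sum.inr (Sum.inr p))) := by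
    intro z
    ext p q
    simp only [Matrix.map_apply, P]
    rw [fam_map]
    simp
  obtain ⟨δ, hδ, hδ2, hδε⟩ : ∃ δ : ℚ, 0 < δ ∧ δ ≤ 1 / 2 ∧ M.card * δ < ε := by
    refine ⟨min (1 / 2) (ε / (M.card + 1)), lt_min (by norm_num) (by positivity), min_le_left _ _, ?_⟩
    have h1 : min (1 / 2) (ε / (M.card + 1)) ≤ ε / ((M.card : ℚ) + 1) := min_le_right _ _
    refine lt_of_le_of_lt (mul_le_mul_of_nonneg_left h1 (by positivity)) ?_
    rw [mul_div_assoc', div_lt_iff₀ (by positivity)]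
    nlinarith
  obtain ⟨z, hz, hz'⟩ := exists_small_point
    (ι := (N × N × Finset N) ⊕ Finset N)
    (Sum.elim (fun t => apminor P t.1 t.2.1 t.2.2) (fun S => pminor P S)) δ hδ
  set Γ := fam i j M J (fun p q => z (Sum.inl (p, q))) (fun p q => z (Sum.inr (Sum.inl (p, q))))
        (fun p => z (Sum.inr (Sum.inr p))) with hΓ
  have hsymm : Γ.IsSymm := fam_symm _ _ _ _ _ _ _ hij
  refine ⟨Γ, hsymm, ?_, ?_, ?_⟩
  · intro S
    have := hz' (Sum.inr S)
    simp only [Sum.elim_inr] at this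
    rw [pminor_map, hP] at this
    apply this
    intro h0
    have h1 := congrArg (MvPolynomial.eval (fun _ => (0 : ℚ))) h0
    rw [pminor_map, hP, map_zero] at h1
    refine pminor_ne_zero _ S id ?_ ?_ h1
    · intro k _; simp [fam, hJ1]
    · intro k _ l _ hkl
      simp [fam, famA, famU, famV, hkl]
      split_ifs <;> norm_num
  · ext s
    constructor
    · intro hs
      by_contra hsG
      obtain ⟨p, q, hpq, b, c, x, hne⟩ := exists_point i j M hij hMcard hiM hjM hN J hJ s hs.1 hsG
      have := hz' (Sum.inl (p, q, s.2))
      simp only [Sum.elim_inl] at this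
      rw [apminor_map, hP] at this
      refine this ?_ (hs.2 p q hpq)
      intro h0
      have h1 := congrArg (MvPolynomial.eval
        (Sum.elim (fun t : N × N => b t.1 t.2) (Sum.elim (fun t : N × N => c t.1 t.2) x))) h0
      rw [apminor_map, hP, map_zero] at h1
      exact hne h1
    · intro hs
      refine ⟨(gaussoid_part i j M hij hMcard hiM hjM).1 s hs, ?_⟩
      have h0 : apminor Γ i j s.2 = 0 := by
        rcases hs with rfl | rfl
        · rw [apminor_empty]
          simp [hΓ, fam, hij]
        · exact apminor_fam_M _ _ _ _ _ _ _ hij hiM hjM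
      have he : s.1 = s(i, j) := by rcases hs with rfl | rfl <;> rfl
      intro p q hpq
      rw [he, Sym2.eq_iff] at hpq
      rcases hpq with ⟨rfl, rfl⟩ | ⟨rfl, rfl⟩
      · exact h0
      · rw [apminor_symm_s14 _ hsymm]; exact h0
  · exact fam_near i j M hMcard J hJ1 _ _ _ δ ε hδ hδ2 hδε (fun _ _ => hz _) (fun _ _ => hz _)
      (fun _ => hz _)
end
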